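/- Suppose dim V = n ≥ 2r. Then for 1 ≤ l ≤ r, dim B(ε,n,r)_l = C(r,l)² · (2l-1)!!, and hence dim B(ε,n,r) = 1 + Σ_{l=1}^{r} C(r,l)²·(2l-1)!!. -/

import Mathlib

open Finset Matrix

namespace EnhancedBrauer

/- Coordinates: `V = ℂⁿ` with a nondegenerate bilinear form of matrix `Q`; the enhanced space
`V̲ = V ⊕ ℂη` is `ℂ^{n+1}`, the index `Fin.last n` playing the role of `η`.  The enhanced
tensor power `V̲^{⊗r}` is `(Fin r → Fin (n+1)) → ℂ`, and its linear endomorphisms are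
matrices indexed by `Fin r → Fin (n+1)` (acting by `mulVec`/`mulVecLin`).  For
`I ⊆ {1,…,r}`, the summand `V̲_I^{⊗r}` is spanned by the basis indices `k` with
`k i ≠ Fin.last n` exactly for `i ∈ I`. -/

/-- Coordinate matrix of the diagonal action of `g` on the `m`-th tensor power of `ℂ^N`. -/
noncomputable def PhiMat {N m : ℕ} (g : Matrix (Fin N) (Fin N) ℂ) :
    Matrix (Fin m → Fin N) (Fin m → Fin N) ℂ :=
  fun k q => ∏ i, g (k i) (q i)

/-- Coordinate matrix of the place-permutation action of `s ∈ 𝔖_m`. -/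
noncomputable def PsiMat {N m : ℕ} (s : Equiv.Perm (Fin m)) :
    Matrix (Fin m → Fin N) (Fin m → Fin N) ℂ :=
  fun k q => if q = k ∘ s then 1 else 0

/-- The index `k` has support exactly `I` (i.e. the corresponding basis vector of the
enhanced tensor power lies in `V̲_I^{⊗r}`). -/
def isSupp {n r : ℕ} (I : Finset (Fin r)) (k : Fin r → Fin (n + 1)) : Prop :=
  ∀ i, i ∈ I ↔ k i ≠ Fin.last n

/-- The number of tensor factors of the basis index `k` coming from `V` (and not `η`). -/
def levelOf {n r : ℕ} (k : Fin r → Fin (n + 1)) : ℕ :=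
  (Finset.univ.filter fun i => k i ≠ Fin.last n).card

/-- The basis index of `V̲_I^{⊗r}` whose `V`-entries are given by `a : Fin l → Fin n`,
arranged along the increasing enumeration of `I`. -/
noncomputable def emb {n r l : ℕ} (I : Finset (Fin r)) (hI : I.card = l)
    (a : Fin l → Fin n) : Fin r → Fin (n + 1) :=
  fun i => if h : i ∈ I then Fin.castSucc (a ((I.orderIsoOfFin hI).symm ⟨i, h⟩)) else Fin.last n

/-- The operator `σ^I` acting as `σ = A` on `V̲_I^{⊗r} ≅ V^{⊗l}` and as `0` on every other
summand `V̲_K^{⊗r}`. -/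
noncomputable def opMat {n r l : ℕ} (I : Finset (Fin r)) (hI : I.card = l)
    (A : Matrix (Fin l → Fin n) (Fin l → Fin n) ℂ) :
    Matrix (Fin r → Fin (n + 1)) (Fin r → Fin (n + 1)) ℂ :=
  fun k q => ∑ a : Fin l → Fin n, ∑ b : Fin l → Fin n,
    if k = emb I hI a ∧ q = emb I hI b then A a b else 0

/-- The operator `E_{I,J}`: the order-preserving place permutation carrying `V̲_J^{⊗r}`
onto `V̲_I^{⊗r}`, extended by zero on all other summands. -/
noncomputable def EMat {n r l : ℕ} (I J : Finset (Fin r)) (hI : I.card = l)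
    (hJ : J.card = l) :
    Matrix (Fin r → Fin (n + 1)) (Fin r → Fin (n + 1)) ℂ :=
  fun k q => ∑ a : Fin l → Fin n, if k = emb I hI a ∧ q = emb J hJ a then 1 else 0

/-- The Brauer algebra `B_l(εn) = End_G(V^{⊗l})`: all matrices commuting with the diagonal
action of the isometry group `G` of the form with matrix `Q`. -/
def BrauerSet (n l : ℕ) (Q : Matrix (Fin n) (Fin n) ℂ) :
    Set (Matrix (Fin l → Fin n) (Fin l → Fin n) ℂ) :=
  {A | ∀ g : Matrix (Fin n) (Fin n) ℂ, gᵀ * Q * g = Q → PhiMat g * A = A * PhiMat g}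

/-- The restriction `Ψ̲|_l(s)` of the place permutation action to the level-`l` summand
`V̲_l^{⊗r}`, extended by zero on the other levels. -/
noncomputable def PsiLevel {n r : ℕ} (l : ℕ) (s : Equiv.Perm (Fin r)) :
    Matrix (Fin r → Fin (n + 1)) (Fin r → Fin (n + 1)) ℂ :=
  fun k q => if levelOf (n := n) k = l ∧ q = k ∘ s then 1 else 0

/-- The enhanced Brauer algebra `B(ε,n,r)`: the (non-unital) subalgebra of
`End_ℂ(V̲^{⊗r})` generated by `Ψ(𝔖_r)` and all `σ^I` with `σ ∈ B_{#I}(εn)`. -/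
noncomputable def enhancedBrauer (n r : ℕ) (Q : Matrix (Fin n) (Fin n) ℂ) :
    NonUnitalSubalgebra ℂ (Matrix (Fin r → Fin (n + 1)) (Fin r → Fin (n + 1)) ℂ) :=
  NonUnitalAlgebra.adjoin ℂ
    ({M | ∃ s : Equiv.Perm (Fin r), M = PsiMat s} ∪
      {M | ∃ I : Finset (Fin r), ∃ A ∈ BrauerSet n I.card Q, M = opMat I rfl A})

/-- The level-`l` piece `B(ε,n,r)_l`: the (non-unital) subalgebra of `End_ℂ(V̲^{⊗r})`
generated by `Ψ̲|_l(𝔖_r)` and all `σ^I` with `#I = l`, `σ ∈ B_l(εn)`. -/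
noncomputable def enhancedBrauerLevel (n r : ℕ) (Q : Matrix (Fin n) (Fin n) ℂ) (l : ℕ) :
    NonUnitalSubalgebra ℂ (Matrix (Fin r → Fin (n + 1)) (Fin r → Fin (n + 1)) ℂ) :=
  NonUnitalAlgebra.adjoin ℂ
    ({M | ∃ s : Equiv.Perm (Fin r), M = PsiLevel l s} ∪
      {M | ∃ I : Finset (Fin r), ∃ hI : I.card = l, ∃ A ∈ BrauerSet n l Q,
        M = opMat I hI A})

set_option linter.unusedSimpArgs false
def IsInv {ι X : Type} [Fintype ι] [Fintype X] [DecidableEq ι] (g : Matrix X X ℂ)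
    (F : (ι → X) → ℂ) : Prop :=
  ∀ t, ∑ s : ι → X, (∏ i, g (s i) (t i)) * F s = F t

def monoMat {X : Type} [DecidableEq X] (σ : X → X) (ε : X → ℂ) : Matrix X X ℂ :=
  Matrix.of fun x y => if x = σ y then ε y else 0

theorem monoMat_pres {X : Type} [Fintype X] [DecidableEq X] (σ : X → X) (ε : X → ℂ)
    (Q : Matrix X X ℂ) (h : ∀ x y, ε x * Q (σ x) (σ y) * ε y = Q x y) :
    (monoMat σ ε)ᵀ * Q * monoMat σ ε = Q := by
  ext x y
  rw [Matrix.mul_apply, Finset.sum_eq_single (σ y), Matrix.mul_apply,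
    Finset.sum_eq_single (σ x), ← h x y]
  · simp [monoMat]
  · intro z _ hz
    simp [monoMat, hz]
  · simp
  · intro z _ hz
    simp [monoMat, hz]
  · simp

theorem isInv_monomial {ι X : Type} [Fintype ι] [Fintype X] [DecidableEq ι] [DecidableEq X]
    (σ : X → X) (ε : X → ℂ) (F : (ι → X) → ℂ)
    (h : IsInv (monoMat σ ε) F) (t : ι → X) :
    (∏ i, ε (t i)) * F (σ ∘ t) = F t := by
  rw [← h t, Finset.sum_eq_single (σ ∘ t)]
  · simp [monoMat]
  · intro s _ hs
    obtain ⟨i, hi⟩ : ∃ i, s i ≠ σ (t i) := by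
      by_contra! hc
      exact hs (funext hc)
    rw [Finset.prod_eq_zero (Finset.mem_univ i), zero_mul]
    simp [monoMat, hi]
  · simp

def rotMat {Y : Type} [DecidableEq Y] (i j : Y) (c : ℂ) : Matrix Y Y ℂ := fun x y =>
  if y = i then (if x = i ∨ x = j then c else 0)
  else if y = j then (if x = i then c else if x = j then -c else 0)
  else if x = y then 1 else 0

theorem rotMat_orth {Y : Type} [Fintype Y] [DecidableEq Y] (i j : Y) (hij : i ≠ j) (c : ℂ)
    (hc : c * c = 1 / 2) : (rotMat i j c)ᵀ * rotMat i j c = 1 := by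
  have key : ∀ x, ∀ f : Y → ℂ, (∀ z, z ≠ i → z ≠ j → z ≠ x → f z = 0) → i ≠ x → j ≠ x →
      ∑ z, f z = f i + f j + f x := by
    intro x f hf h1 h2
    rw [← Finset.sum_subset (Finset.subset_univ {i, j, x})]
    · rw [Finset.sum_insert (by simp [hij, h1]), Finset.sum_insert (by simp [h2])]
      simp [add_assoc]
    · intro z _ hz
      simp at hz
      exact hf z hz.1 hz.2.1 hz.2.2
  have key2 : ∀ f : Y → ℂ, (∀ z, z ≠ i → z ≠ j → f z = 0) → 
      ∑ z, f z = f i + f j := by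
    intro f hf
    rw [← Finset.sum_subset (Finset.subset_univ {i, j})]
    · rw [Finset.sum_insert (by simp [hij])]
      simp 
    · intro z _ hz
      simp at hz
      exact hf z hz.1 hz.2
  ext x y
  rw [Matrix.mul_apply]
  simp only [Matrix.transpose_apply, Matrix.one_apply]
  by_cases hx : x = i ∨ x = j
  · rw [key2]
    · rcases hx with rfl | rfl
      · by_cases hy : y = x
        · subst hy; simp [rotMat, hij.symm]; linear_combination 2 * hc
        · by_cases hy' : y = j
          · subst hy'; simp [rotMat, hij, hij.symm]
          · simp [rotMat, hij, hy, hy', Ne.symm hy, Ne.symm hy', hij.symm]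
      · by_cases hy : y = i
        · subst hy; simp [rotMat, hij, hij.symm]
        · by_cases hy' : y = x
          · subst hy'; simp [rotMat, hij, hij.symm]; linear_combination 2 * hc
          · simp [rotMat, hij, hy, hy', Ne.symm hy, Ne.symm hy', hij.symm]
    · intro z h1 h2
      rcases hx with rfl | rfl <;> simp [rotMat, h1, h2, hij.symm]
  · push Not at hx
    rw [key x _ _ hx.1.symm hx.2.symm]
    · by_cases hy : y = i
      · subst hy; simp [rotMat, hij, hij.symm, hx, hx.1.symm, hx.2.symm]
      · by_cases hy' : y = j
        · subst hy'; simp [rotMat, hij, hij.symm, hx, hx.1.symm, hx.2.symm]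
        · simp [rotMat, hij, hx, hx.1.symm, hx.2.symm, hy, hy', Ne.symm hy, Ne.symm hy']
    · intro z h1 h2 h3
      simp [rotMat, hx, h3]

theorem lemmaA {ι Y : Type} [Fintype ι] [Fintype Y] [DecidableEq ι] [DecidableEq Y]
    (F : (ι → Y) → ℂ) (hF : ∀ g : Matrix Y Y ℂ, gᵀ * g = 1 → IsInv g F)
    (hc : Fintype.card ι ≤ 2 * Fintype.card Y)
    (h0 : ∀ t : ι → Y, (∀ i, (Finset.univ.filter fun j => t j = t i).card = 2) → F t = 0) :
    ∀ t, F t = 0 := by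
  have main : ∀ (d : ℕ) (t : ι → Y),
      Fintype.card Y - (Finset.univ.image t).card = d → F t = 0 := by
    intro d
    induction d using Nat.strong_induction_on with
    | _ d ih =>
    intro t ht
    by_cases hodd : ∃ i, Odd (Finset.univ.filter fun j => t j = t i).card
    · obtain ⟨i, hi⟩ := hodd
      have hm := isInv_monomial id (fun y => if y = t i then (-1 : ℂ) else 1) F
        (hF _ (by
          have := monoMat_pres id (fun y => if y = t i then (-1 : ℂ) else 1) 1 (by
            intro x y
            by_cases hxy : x = y
            · subst hxy; simp; split_ifs <;> simp
            · simp [Matrix.one_apply, hxy])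
          simpa using this)) t
      rw [Finset.prod_ite, Finset.prod_const, Finset.prod_const_one, hi.neg_one_pow] at hm
      simp only [id, Function.id_comp] at hm
      linear_combination (-1/2) * hm
    · push Not at hodd
      by_cases h2 : ∀ i, (Finset.univ.filter fun j => t j = t i).card = 2
      · exact h0 t h2
      push Not at h2
      obtain ⟨i, hi⟩ := h2
      have hev : ∀ i, Even (Finset.univ.filter fun j => t j = t i).card := by
        intro i; simpa using hodd i
      have hpos : ∀ i, 0 < (Finset.univ.filter fun j => t j = t i).card := by
        intro i; exact Finset.card_pos.2 ⟨i, by simp⟩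
      obtain ⟨m, hm⟩ := hev i
      have hm2 : 2 ≤ m := by have := hpos i; omega
      have hcard : Fintype.card ι = ∑ y ∈ Finset.univ.image t,
          (Finset.univ.filter fun j => t j = y).card := by
        rw [← Finset.card_univ]
        exact Finset.card_eq_sum_card_image t Finset.univ
      have hlt : 2 * (Finset.univ.image t).card < Fintype.card ι := by
        rw [hcard, mul_comm, ← smul_eq_mul, ← Finset.sum_const]
        apply Finset.sum_lt_sum
        · intro y hy
          obtain ⟨k, -, rfl⟩ := Finset.mem_image.1 hy
          obtain ⟨q, hq⟩ := hev k
          have := hpos k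
          omega
        · exact ⟨t i, Finset.mem_image_of_mem _ (Finset.mem_univ _), by omega⟩
      obtain ⟨j, hj⟩ : ∃ j, j ∉ Finset.univ.image t := by
        by_contra! hall
        have : Finset.univ.image t = Finset.univ := Finset.eq_univ_iff_forall.2 hall
        rw [this, Finset.card_univ] at hlt
        omega
      have hj' : ∀ k, t k ≠ j := by
        intro k hk; exact hj (hk ▸ Finset.mem_image_of_mem _ (Finset.mem_univ _))
      obtain ⟨c, hcc⟩ : ∃ c : ℂ, c * c = 1 / 2 := by
        obtain ⟨c, hc⟩ := IsAlgClosed.exists_pow_nat_eq (1/2 : ℂ) (n := 2) (by norm_num)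
        exact ⟨c, by rw [← hc]; ring⟩
      have hrot := hF _ (rotMat_orth (t i) j (hj' i) c hcc) t
      have hswap := isInv_monomial (Equiv.swap (t i) j) (fun _ => (1:ℂ)) F
        (hF _ (by
          have := monoMat_pres (Equiv.swap (t i) j) (fun _ => (1:ℂ)) 1 (by
            intro x y
            simp [Matrix.one_apply])
          simpa using this)) t
      simp only [Finset.prod_const_one, one_mul] at hswap
      have hne : t ≠ Equiv.swap (t i) j ∘ t := by
        intro h
        have := congrFun h i
        simp at this
        exact hj' i this
      have hc1 : ∏ k, rotMat (t i) j c (t k) (t k) = (1/2) ^ m := by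
        have : ∀ k, rotMat (t i) j c (t k) (t k) = if t k = t i then c else 1 := by
          intro k
          by_cases hk : t k = t i
          · simp [rotMat, hk]
          · simp [rotMat, hk, hj' k]
        simp only [this]
        rw [Finset.prod_ite, Finset.prod_const, Finset.prod_const_one, hm, ← two_mul, pow_mul, pow_two, hcc, mul_one]
      have hc2 : ∏ k, rotMat (t i) j c ((Equiv.swap (t i) j ∘ t) k) (t k) = (1/2) ^ m := by
        have : ∀ k, rotMat (t i) j c ((Equiv.swap (t i) j ∘ t) k) (t k) = if t k = t i then c else 1 := by
          intro k
          by_cases hk : t k = t i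
          · simp [rotMat, hk]
          · simp [rotMat, hk, hj' k, Equiv.swap_apply_of_ne_of_ne hk (hj' k)]
        simp only [this]
        rw [Finset.prod_ite, Finset.prod_const, Finset.prod_const_one, hm, ← two_mul, pow_mul, pow_two, hcc, mul_one]
      rw [Fintype.sum_eq_add t (Equiv.swap (t i) j ∘ t) hne, hc1, hc2, hswap] at hrot
      · have h3 : (1 - 2 * (1/2 : ℂ) ^ m) * F t = 0 := by linear_combination - hrot
        rcases mul_eq_zero.1 h3 with h | h
        · exfalso
          obtain ⟨q, rfl⟩ := Nat.exists_eq_add_of_le hm2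
          have h4 : (2:ℂ) ^ (q+1) = 1 := by
            have h5 : ((1:ℂ)/2) ^ q * 2 ^ q = 1 := by rw [← mul_pow]; norm_num
            rw [pow_add] at h
            rw [pow_succ]
            linear_combination 2 ^ q * 2 * h + h5
          have h6 : (2:ℕ) ^ (q+1) = 1 := by exact_mod_cast h4
          simp at h6
        · exact h
      · rintro s ⟨hs1, hs2⟩
        by_cases hz : ∃ k, rotMat (t i) j c (s k) (t k) = 0
        · obtain ⟨k, hk⟩ := hz
          rw [Finset.prod_eq_zero (Finset.mem_univ k) hk, zero_mul]
        push Not at hz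
        have hs3 : ∀ k, t k ≠ t i → s k = t k := by
          intro k hk
          by_contra h
          exact hz k (by simp [rotMat, hk, hj' k, h])
        have hs4 : ∀ k, t k = t i → s k = t i ∨ s k = j := by
          intro k hk
          by_contra h
          exact hz k (by simp only [rotMat, hk, if_true]; rw [if_neg h])
        obtain ⟨k1, hk1⟩ : ∃ k, s k ≠ t k := by
          by_contra! h; exact hs1 (funext h)
        obtain ⟨k2, hk2⟩ : ∃ k, s k ≠ Equiv.swap (t i) j (t k) := by
          by_contra! h; exact hs2 (funext h)
        have hk1' : s k1 = j := by
          by_cases h : t k1 = t i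
          · rcases hs4 k1 h with h' | h'
            · exact absurd (h'.trans h.symm) hk1
            · exact h'
          · exact absurd (hs3 k1 h) hk1
        have hk2' : s k2 = t i := by
          by_cases h : t k2 = t i
          · rcases hs4 k2 h with h' | h'
            · exact h'
            · rw [h, Equiv.swap_apply_left] at hk2; exact absurd h' hk2
          · rw [Equiv.swap_apply_of_ne_of_ne h (hj' k2)] at hk2
            exact absurd (hs3 k2 h) hk2
        have hsub : Finset.univ.image t ⊂ Finset.univ.image s := by
          refine Finset.ssubset_iff_of_subset ?_ |>.2 ⟨j, ?_, hj⟩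
          · intro y hy
            obtain ⟨k, -, rfl⟩ := Finset.mem_image.1 hy
            by_cases h : t k = t i
            · rw [h, ← hk2']; exact Finset.mem_image_of_mem _ (Finset.mem_univ _)
            · rw [← hs3 k h]; exact Finset.mem_image_of_mem _ (Finset.mem_univ _)
          · rw [← hk1']; exact Finset.mem_image_of_mem _ (Finset.mem_univ _)
        have hlt2 := Finset.card_lt_card hsub
        have hle : (Finset.univ.image s).card ≤ Fintype.card Y := Finset.card_le_univ _
        rw [ih _ (by omega) s rfl, mul_zero]
  exact fun t => main _ t rfl
def sig0 (l : ℕ) : Equiv.Perm (Fin l ⊕ Fin l) := Equiv.sumComm _ _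

theorem cycleType_invol {l : ℕ} (π : Equiv.Perm (Fin l ⊕ Fin l)) (h1 : ∀ i, π (π i) = i)
    (h2 : ∀ i, π i ≠ i) : π.cycleType = Multiset.replicate l 2 := by
  have hsq : π ^ 2 = 1 := by
    ext i : 1
    simp [pow_two, h1]
  have hall := (Equiv.Perm.pow_prime_eq_one_iff (p := 2)).1 hsq
  have hrep := Multiset.eq_replicate_card.2 hall
  have hsum := π.sum_cycleType
  have hsupp : π.support = Finset.univ := by
    ext i; simp [h2]
  rw [hsupp, Finset.card_univ, hrep, Multiset.sum_replicate] at hsum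
  simp at hsum
  rw [hrep]
  congr 1
  omega

theorem sig0_cycleType (l : ℕ) : (sig0 l).cycleType = Multiset.replicate l 2 :=
  cycleType_invol _ (by rintro (i | i) <;> rfl) (by rintro (i | i) <;> simp [sig0])

abbrev Pr (l : ℕ) := {π : Equiv.Perm (Fin l ⊕ Fin l) // π.cycleType = Multiset.replicate l 2}

theorem card_Pr (l : ℕ) : Fintype.card (Pr l) = Nat.doubleFactorial (2 * l - 1) := by
  rw [Fintype.card_subtype]
  have h := Equiv.Perm.card_of_cycleType_mul_eq (α := Fin l ⊕ Fin l) (Multiset.replicate l 2)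
  rcases Nat.eq_zero_or_pos l with rfl | hl
  · simpa using h
  rw [if_pos] at h
  · have h1 : (∏ n ∈ (Multiset.replicate l 2).toFinset,
        Nat.factorial ((Multiset.replicate l 2).count n)) = Nat.factorial l := by
      rw [Multiset.toFinset_replicate, if_neg hl.ne']
      simp
    rw [h1] at h
    simp only [Multiset.sum_replicate, Multiset.prod_replicate, Fintype.card_sum, Fintype.card_fin,
      smul_eq_mul] at h
    have h2 : l + l - l * 2 = 0 := by omega
    rw [h2, Nat.factorial_zero, one_mul, ← Nat.doubleFactorial_two_mul] at h
    obtain ⟨k, rfl⟩ : ∃ k, l = k + 1 := ⟨l - 1, by omega⟩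
    have h3 := Nat.factorial_eq_mul_doubleFactorial (2 * k + 1)
    have h4 : 2 * (k + 1) - 1 = 2 * k + 1 := by omega
    rw [h4]
    have h5 : k + 1 + (k + 1) = 2 * k + 1 + 1 := by ring
    have h6 : 2 * (k + 1) = 2 * k + 1 + 1 := by ring
    rw [h5, h6, h3, mul_comm] at h
    exact Nat.eq_of_mul_eq_mul_left (Nat.doubleFactorial_pos _) h
  · constructor
    · simp; omega
    · intro a ha
      rw [Multiset.eq_of_mem_replicate ha]

theorem exists_conj {l : ℕ} (π : Pr l) :
    ∃ e : Equiv.Perm (Fin l ⊕ Fin l), ∀ k, π.1 (e (Sum.inl k)) = e (Sum.inr k) := by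
  have h : IsConj (sig0 l) π.1 := by
    rw [Equiv.Perm.isConj_iff_cycleType_eq, π.2, sig0_cycleType]
  obtain ⟨e, he⟩ := isConj_iff.1 h
  refine ⟨e, fun k => ?_⟩
  rw [← he]
  simp [sig0]

noncomputable def ePr {l : ℕ} (π : Pr l) : Equiv.Perm (Fin l ⊕ Fin l) := (exists_conj π).choose

theorem ePr_spec {l : ℕ} (π : Pr l) (k : Fin l) :
    π.1 (ePr π (Sum.inl k)) = ePr π (Sum.inr k) := (exists_conj π).choose_spec k

theorem Pr_invol {l : ℕ} (π : Pr l) (i) : π.1 (π.1 i) = i := by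
  have := (Equiv.Perm.pow_prime_eq_one_iff (p := 2) (σ := π.1)).2 (by
    intro c hc; rw [π.2] at hc; exact Multiset.eq_of_mem_replicate hc)
  have h2 := congrArg (fun σ => σ i) this
  simpa [pow_two] using h2

theorem ePr_spec' {l : ℕ} (π : Pr l) (k : Fin l) :
    π.1 (ePr π (Sum.inr k)) = ePr π (Sum.inl k) := by
  rw [← ePr_spec, Pr_invol]

def fold {l : ℕ} : Fin l ⊕ Fin l → Fin l := Sum.elim id id

theorem Pr_eq_of {l : ℕ} (π π' : Pr l)
    (h : ∀ k, fold ((ePr π').symm (ePr π (Sum.inl k))) = fold ((ePr π').symm (ePr π (Sum.inr k)))) :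
    π = π' := by
  have key : ∀ a b : Fin l ⊕ Fin l, a ≠ b → fold ((ePr π').symm a) = fold ((ePr π').symm b) →
      π'.1 a = b := by
    intro a b hab hf
    obtain ⟨x, rfl⟩ := (ePr π').surjective a
    obtain ⟨y, rfl⟩ := (ePr π').surjective b
    simp only [Equiv.symm_apply_apply] at hf
    rcases x with x | x <;> rcases y with y | y <;> simp [fold] at hf <;> subst hf
    · exact absurd rfl hab
    · exact ePr_spec π' _
    · exact ePr_spec' π' _
    · exact absurd rfl hab
  apply Subtype.ext
  ext a : 1
  obtain ⟨x, rfl⟩ := (ePr π).surjective a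
  rcases x with x | x
  · rw [ePr_spec]
    exact (key _ _ (by simp) (h x)).symm
  · rw [ePr_spec']
    exact (key _ _ (by simp) (h x).symm).symm

theorem exists_Pr_of_fibers {l : ℕ} {Y : Type} [DecidableEq Y] (t : Fin l ⊕ Fin l → Y)
    (ht : ∀ i, (Finset.univ.filter fun j => t j = t i).card = 2) :
    ∃ (π : Pr l) (c : Fin l → Y), Function.Injective c ∧ t = fun i => c (fold ((ePr π).symm i)) := by
  have h1 : ∀ i, ∃ j, j ≠ i ∧ t j = t i ∧ ∀ k, t k = t i → k = i ∨ k = j := by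
    intro i
    obtain ⟨x, y, hxy, h⟩ := Finset.card_eq_two.1 (ht i)
    have hm : ∀ k, t k = t i ↔ k = x ∨ k = y := by
      intro k
      have := Finset.ext_iff.1 h k
      simpa using this
    rcases (hm i).1 rfl with h' | h'
    · exact ⟨y, by rw [h']; exact hxy.symm, (hm y).2 (Or.inr rfl), fun k hk => by
        rw [h']; exact (hm k).1 hk⟩
    · exact ⟨x, by rw [h']; exact hxy, (hm x).2 (Or.inl rfl), fun k hk => by
        rw [h']; exact ((hm k).1 hk).symm⟩
  choose p hp1 hp2 hp3 using h1
  have hpp : ∀ i, p (p i) = i := by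
    intro i
    rcases hp3 i (p (p i)) ((hp2 _).trans (hp2 _)) with h | h
    · exact h
    · exact absurd h (hp1 _)
  let π0 : Equiv.Perm (Fin l ⊕ Fin l) := ⟨p, p, hpp, hpp⟩
  let π : Pr l := ⟨π0, cycleType_invol π0 hpp hp1⟩
  have hr : ∀ k, t (ePr π (Sum.inr k)) = t (ePr π (Sum.inl k)) := by
    intro k
    rw [← ePr_spec]
    exact hp2 _
  refine ⟨π, fun k => t (ePr π (Sum.inl k)), ?_, ?_⟩
  · intro a b hab
    rcases hp3 (ePr π (Sum.inl b)) _ hab with h | h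
    · simpa using h
    · have h' : ePr π (Sum.inl a) = ePr π (Sum.inr b) := h.trans (ePr_spec π b)
      simp at h'
  · funext i
    obtain ⟨x, rfl⟩ := (ePr π).surjective i
    rcases x with x | x
    · simp [fold]
    · simp [fold, hr]
def InvSub (l : ℕ) {X : Type} [Fintype X] [DecidableEq X] (Q : Matrix X X ℂ) :
    Submodule ℂ ((Fin l ⊕ Fin l → X) → ℂ) where
  carrier := {F | ∀ g : Matrix X X ℂ, gᵀ * Q * g = Q → IsInv g F}
  add_mem' := by
    intro F G hF hG g hg t
    simp only [Pi.add_apply, mul_add, Finset.sum_add_distrib]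
    rw [hF g hg t, hG g hg t]
  zero_mem' := by
    intro g hg t
    simp
  smul_mem' := by
    intro c F hF g hg t
    simp only [Pi.smul_apply, smul_eq_mul]
    rw [← hF g hg t, Finset.mul_sum]
    exact Finset.sum_congr rfl fun s _ => by ring

def pairF {l : ℕ} {X : Type} (Q : Matrix X X ℂ) (e : Equiv.Perm (Fin l ⊕ Fin l)) :
    (Fin l ⊕ Fin l → X) → ℂ := fun t => ∏ k, Q (t (e (Sum.inl k))) (t (e (Sum.inr k)))

def reEq {l : ℕ} (X : Type) (e : Equiv.Perm (Fin l ⊕ Fin l)) :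
    (Fin l → X × X) ≃ (Fin l ⊕ Fin l → X) where
  toFun w i := Sum.elim (fun k => (w k).1) (fun k => (w k).2) (e.symm i)
  invFun s k := (s (e (Sum.inl k)), s (e (Sum.inr k)))
  left_inv w := by funext k; simp
  right_inv s := by
    funext i
    obtain ⟨x, rfl⟩ := e.surjective i
    rcases x with x | x <;> simp

theorem pairF_mem {l : ℕ} {X : Type} [Fintype X] [DecidableEq X] (Q : Matrix X X ℂ)
    (e : Equiv.Perm (Fin l ⊕ Fin l)) : pairF Q e ∈ InvSub l Q := by
  intro g hg t
  rw [← (reEq X e).sum_comp]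
  have h1 : ∀ w : Fin l → X × X,
      (∏ i, g (reEq X e w i) (t i)) * pairF Q e (reEq X e w) =
      ∏ k, (g (w k).1 (t (e (Sum.inl k))) * Q (w k).1 (w k).2 * g (w k).2 (t (e (Sum.inr k)))) := by
    intro w
    rw [← Equiv.prod_comp e, Fintype.prod_sum_type, pairF, ← Finset.prod_mul_distrib,
      ← Finset.prod_mul_distrib]
    apply Finset.prod_congr rfl
    intro k _
    simp only [reEq, Equiv.coe_fn_mk, Equiv.symm_apply_apply, Sum.elim_inl, Sum.elim_inr]
    ring
  simp only [h1]
  rw [← Fintype.prod_sum (fun k (p : X × X) => g p.1 (t (e (Sum.inl k))) * Q p.1 p.2 * g p.2 (t (e (Sum.inr k))))]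
  unfold pairF
  apply Finset.prod_congr rfl
  intro k _
  conv_rhs => rw [← hg]
  rw [Matrix.mul_apply, Fintype.sum_prod_type_right]
  apply Finset.sum_congr rfl
  intro y _
  rw [Matrix.mul_apply, Finset.sum_mul]
  rfl

def QT (Y : Type) {T : Type} [DecidableEq Y] (q : Matrix T T ℂ) : Matrix (Y × T) (Y × T) ℂ :=
  Matrix.of fun x y => if x.1 = y.1 then q x.2 y.2 else 0

theorem exists_perm_ext {l : ℕ} {Y : Type} [Fintype Y] [DecidableEq Y] (c c' : Fin l → Y)
    (hc : Function.Injective c) (hc' : Function.Injective c') :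
    ∃ σ : Equiv.Perm Y, ∀ k, σ (c k) = c' k := by
  classical
  let E := (Equiv.ofInjective c hc).symm.trans (Equiv.ofInjective c' hc')
  refine ⟨E.extendSubtype, fun k => ?_⟩
  rw [Equiv.extendSubtype_apply_of_mem E (c k) ⟨k, rfl⟩]
  simp [E]

def stdT {l : ℕ} {T : Type} (a b : T) : Fin l ⊕ Fin l → T := Sum.elim (fun _ => a) (fun _ => b)

theorem finrank_Inv {l : ℕ} {Y T : Type} [Fintype Y] [DecidableEq Y] [Fintype T] [DecidableEq T]
    (q : Matrix T T ℂ) (a b : T) (hq : q a b = 1) (hl : l ≤ Fintype.card Y)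
    (H : ∀ F ∈ InvSub l (QT Y q), ∀ (e : Equiv.Perm (Fin l ⊕ Fin l)) (c : Fin l → Y),
      Function.Injective c → F (fun i => (c (fold (e.symm i)), stdT a b (e.symm i))) = 0 →
      ∀ τ : Fin l ⊕ Fin l → T, F (fun i => (c (fold (e.symm i)), τ i)) = 0) :
    Module.finrank ℂ (InvSub l (QT Y q)) = Nat.doubleFactorial (2 * l - 1) := by
  obtain ⟨c0⟩ : Nonempty (Fin l ↪ Y) := Function.Embedding.nonempty_of_card_le (by simpa using hl)
  let x : Pr l → (Fin l ⊕ Fin l → Y × T) := fun π i =>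
    (c0 (fold ((ePr π).symm i)), stdT a b ((ePr π).symm i))
  let ev : InvSub l (QT Y q) →ₗ[ℂ] (Pr l → ℂ) :=
    { toFun := fun F π => F.1 (x π)
      map_add' := fun _ _ => rfl
      map_smul' := fun _ _ => rfl }
  have hinj : Function.Injective ev := by
    rw [← LinearMap.ker_eq_bot, LinearMap.ker_eq_bot']
    intro F hF0
    have hF0' : ∀ π, F.1 (x π) = 0 := fun π => congrFun hF0 π
    have key : ∀ (τ : Fin l ⊕ Fin l → T) (t : Fin l ⊕ Fin l → Y), F.1 (fun i => (t i, τ i)) = 0 := by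
      intro τ
      apply lemmaA (fun t => F.1 (fun i => (t i, τ i)))
      · intro g hg t
        let G : Matrix (Y × T) (Y × T) ℂ := Matrix.of fun x y =>
          if x.2 = y.2 then g x.1 y.1 else 0
        have hG : Gᵀ * QT Y q * G = QT Y q := by
          have hgg : ∀ y y', ∑ z, g z y * g z y' = if y = y' then 1 else 0 := by
            intro y y'
            have := congrFun (congrFun hg y) y'
            rw [Matrix.mul_apply, Matrix.one_apply] at this
            exact this
          ext ⟨y, p⟩ ⟨y', p'⟩
          rw [Matrix.mul_apply]
          simp only [Matrix.mul_apply, Fintype.sum_prod_type, Matrix.transpose_apply, G, QT,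
            Matrix.of_apply, ite_mul, zero_mul, mul_ite, mul_zero, Finset.sum_ite_eq',
            Finset.sum_ite_eq, Finset.mem_univ, if_true]
          have h3 : ∀ z, g z y * q p p' * g z y' = q p p' * (g z y * g z y') := fun z => by ring
          have h4 : ∀ x : Y, (∑ x_1 : Y, ∑ x_2 : T, if x_1 = x then
              (if x_2 = p then g x_1 y * q x_2 p' else 0) else 0) = g x y * q p p' := by
            intro x
            rw [Finset.sum_eq_single x]
            · simp
            · intro z _ hz
              simp [hz]
            · simp
          simp only [h4, h3, ← Finset.mul_sum, hgg]
          simp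
        have h1 := F.2 G hG (fun i => (t i, τ i))
        refine Eq.trans ?_ h1
        let φ : (Fin l ⊕ Fin l → Y) → (Fin l ⊕ Fin l → Y × T) := fun s i => (s i, τ i)
        have hφ : Function.Injective φ := by
          intro s s' h
          funext i
          exact congrArg Prod.fst (congrFun h i)
        rw [← Finset.sum_subset (Finset.subset_univ (Finset.univ.image φ)),
          Finset.sum_image (fun _ _ _ _ h => hφ h)]
        · simp [G, φ]
        · intro s _ hs
          obtain ⟨i, hi⟩ : ∃ i, (s i).2 ≠ τ i := by
            by_contra! h
            apply hs
            refine Finset.mem_image.2 ⟨fun i => (s i).1, Finset.mem_univ _, ?_⟩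
            funext i
            simp [φ, ← h i]
          rw [Finset.prod_eq_zero (Finset.mem_univ i), zero_mul]
          simp [G, hi]
      · simp; omega
      · intro t ht
        obtain ⟨π, c, hc, rfl⟩ := exists_Pr_of_fibers t ht
        apply H F.1 F.2 (ePr π) c hc
        obtain ⟨σ, hσ⟩ := exists_perm_ext c0 c c0.injective hc
        have hm := isInv_monomial (Prod.map σ id) (fun _ => (1:ℂ)) F.1
          (F.2 _ (monoMat_pres _ _ _ (by
            rintro ⟨y, p⟩ ⟨y', p'⟩
            simp [QT]))) (x π)
        rw [hF0' π, Finset.prod_const_one, one_mul] at hm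
        refine Eq.trans (congrArg F.1 ?_) hm
        funext i
        simp [x, hσ]
    apply Subtype.ext
    funext t
    exact key (fun i => (t i).2) (fun i => (t i).1)
  have hsurj : Function.Surjective ev := by
    rw [← LinearMap.range_eq_top, eq_top_iff, ← (Pi.basisFun ℂ (Pr l)).span_eq, Submodule.span_le]
    rintro _ ⟨π, rfl⟩
    refine ⟨⟨pairF (QT Y q) (ePr π), pairF_mem _ _⟩, ?_⟩
    funext π'
    simp only [ev, LinearMap.coe_mk, AddHom.coe_mk, Pi.basisFun_apply]
    by_cases h : π' = π
    · subst h
      simp [pairF, x, QT, fold, stdT, hq]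
    · rw [Pi.single_apply, if_neg h]
      have : ¬ ∀ k, fold ((ePr π').symm (ePr π (Sum.inl k))) =
          fold ((ePr π').symm (ePr π (Sum.inr k))) := fun hh => h (Pr_eq_of π π' hh).symm
      push Not at this
      obtain ⟨k, hk⟩ := this
      rw [pairF, Finset.prod_eq_zero (Finset.mem_univ k)]
      simp [x, QT, hk]
  rw [(LinearEquiv.ofBijective ev ⟨hinj, hsurj⟩).finrank_eq, Module.finrank_fintype_fun_eq_card,
    card_Pr]

theorem finrank_Inv_unit {l : ℕ} {Y : Type} [Fintype Y] [DecidableEq Y] (hl : l ≤ Fintype.card Y) :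
    Module.finrank ℂ (InvSub l (QT Y (1 : Matrix Unit Unit ℂ))) =
      Nat.doubleFactorial (2 * l - 1) := by
  refine finrank_Inv 1 () () (by simp) hl ?_
  intro F _ e c _ h τ
  exact h

def qSp : Matrix Bool Bool ℂ := Matrix.of fun a b =>
  if a = b then 0 else if b then 1 else -1

theorem finrank_Inv_bool {l : ℕ} {Y : Type} [Fintype Y] [DecidableEq Y] (hl : l ≤ Fintype.card Y) :
    Module.finrank ℂ (InvSub l (QT Y qSp)) =
      Nat.doubleFactorial (2 * l - 1) := by
  refine finrank_Inv qSp false true (by simp [qSp]) hl ?_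
  intro F hF e c hc h τ
  by_cases hk : ∃ k, τ (e (Sum.inl k)) = τ (e (Sum.inr k))
  · obtain ⟨k, hk⟩ := hk
    let ε : Y × Bool → ℂ := fun x => if x.1 = c k then (if x.2 then 2 else 1/2) else 1
    have hm := isInv_monomial id ε F (hF _ (monoMat_pres _ _ _ (by
      rintro ⟨y, p⟩ ⟨y', p'⟩
      by_cases hy : y = y'
      · subst hy
        by_cases hy : y = c k
        · cases p <;> cases p' <;> simp [ε, QT, qSp, hy]
        · simp [ε, QT, qSp, hy]
      · simp [QT, hy]))) (fun i => (c (fold (e.symm i)), τ i))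
    rw [← Equiv.prod_comp e, Fintype.prod_sum_type] at hm
    rw [Finset.prod_eq_single k, Finset.prod_eq_single k] at hm
    · simp only [Equiv.symm_apply_apply, fold, Sum.elim_inl, Sum.elim_inr, id, ε, if_true, hk,
        Function.id_comp] at hm
      by_cases hb : τ (e (Sum.inr k)) = true
      · simp only [hb, if_true] at hm
        simp only [fold]
        linear_combination (1/3) * hm
      · simp only [hb] at hm
        simp only [fold]
        norm_num at hm
        linear_combination (-4/3) * hm
    · intro k' _ hk'
      simp [ε, fold, hc.ne hk']
    · simp
    · intro k' _ hk'
      simp [ε, fold, hc.ne hk']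
    · simp
  · push Not at hk
    classical
    let D : Set Y := {y | ∃ k, c k = y ∧ τ (e (Sum.inl k)) = true}
    let σ : Y × Bool → Y × Bool := fun x => (x.1, if x.1 ∈ D then !x.2 else x.2)
    let ε : Y × Bool → ℂ := fun x => if x.1 ∈ D then (if x.2 then -1 else 1) else 1
    have hm := isInv_monomial σ ε F (hF _ (monoMat_pres _ _ _ (by
      rintro ⟨y, p⟩ ⟨y', p'⟩
      by_cases hy : y = y'
      · subst hy
        by_cases hy : y ∈ D
        · cases p <;> cases p' <;> simp [σ, ε, QT, qSp, hy]
        · simp [σ, ε, QT, hy]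
      · simp [σ, QT, hy]))) (fun i => (c (fold (e.symm i)), τ i))
    rw [← hm]
    convert mul_zero _
    rw [← h]
    congr 1
    funext i
    obtain ⟨z, rfl⟩ := e.surjective i
    have hD : ∀ k, c k ∈ D ↔ τ (e (Sum.inl k)) = true := by
      intro k
      constructor
      · rintro ⟨k', h1, h2⟩
        rwa [← hc h1]
      · exact fun h => ⟨k, rfl, h⟩
    rcases z with k | k
    · simp only [σ, Function.comp, Equiv.symm_apply_apply, fold, Sum.elim_inl, id, stdT, hD]
      cases τ (e (Sum.inl k)) <;> simp
    · have := hk k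
      simp only [σ, Function.comp, Equiv.symm_apply_apply, fold, Sum.elim_inr, id, stdT, hD]
      revert this
      cases τ (e (Sum.inl k)) <;> cases τ (e (Sum.inr k)) <;> simp
theorem exists_sympl {V : Type} [AddCommGroup V] [Module ℂ V] [FiniteDimensional ℂ V]
    (B : LinearMap.BilinForm ℂ V) (halt : ∀ x, B x x = 0)
    (hnd : ∀ x, (∀ y, B x y = 0) → x = 0) (k : ℕ) (hk : 2 * k ≤ Module.finrank ℂ V + 1) :
    ∃ v : Fin k × Bool → V, ∀ x y, B (v x) (v y) = QT (Fin k) qSp x y := by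
  have hsk : ∀ x y, B x y = - B y x := by
    intro x y
    have := halt (x + y)
    simp only [map_add, LinearMap.add_apply, halt] at this
    linear_combination this
  induction k with
  | zero => exact ⟨fun x => x.1.elim0, fun x => x.1.elim0⟩
  | succ k ih =>
    obtain ⟨v, hv⟩ := ih (by omega)
    let L : V →ₗ[ℂ] (Fin k × Bool → ℂ) := LinearMap.pi fun x => B (v x)
    have hker : LinearMap.ker L ≠ ⊥ := by
      apply LinearMap.ker_ne_bot_of_finrank_lt
      simp
      omega
    obtain ⟨w, hw, hw0⟩ := Submodule.exists_mem_ne_zero_of_ne_bot hker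
    have hw' : ∀ x, B (v x) w = 0 := fun x => congrFun (LinearMap.mem_ker.1 hw) x
    obtain ⟨y, hy⟩ : ∃ y, B w y ≠ 0 := by
      by_contra! h; exact hw0 (hnd w h)
    let y1 := (B w y)⁻¹ • y
    have hy1 : B w y1 = 1 := by simp [y1, hy]
    let y2 := y1 + ∑ j : Fin k, (B (v (j, true)) y1 • v (j, false) - B (v (j, false)) y1 • v (j, true))
    have hwy2 : B w y2 = 1 := by
      simp only [y2, map_add, map_sum, map_sub, map_smul, hy1]
      simp [hsk w (v _), hw']
    have hvy2 : ∀ x, B (v x) y2 = 0 := by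
      rintro ⟨i, b⟩
      simp only [y2, map_add, map_sum, map_sub, map_smul, hv, QT, qSp, Matrix.of_apply, smul_eq_mul]
      rw [Finset.sum_eq_single i]
      · cases b <;> simp
      · intro j _ hj
        simp [hj.symm]
      · simp
    refine ⟨fun x => Fin.cases (motive := fun _ => V) (if x.2 then y2 else w)
      (fun i => v (i, x.2)) x.1, ?_⟩
    rintro ⟨i, a⟩ ⟨j, b⟩
    refine Fin.cases ?_ (fun i => ?_) i <;> refine Fin.cases ?_ (fun j => ?_) j
    · cases a <;> cases b <;> simp [QT, qSp, halt, hwy2, hsk y2 w]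
    · cases a
      · simp [QT, hsk w (v _), hw', (Fin.succ_ne_zero _).symm]
      · simp [QT, hsk y2 (v _), hvy2, (Fin.succ_ne_zero _).symm]
    · cases b
      · simp [QT, hw']
      · simp [QT, hvy2]
    · simp [hv, QT]

theorem exists_orth {n : ℕ} (Q : Matrix (Fin n) (Fin n) ℂ) (hQ : IsUnit Q) (hs : Qᵀ = Q) :
    ∃ P : Matrix (Fin n) (Fin n) ℂ, Pᵀ * Q * P = 1 := by
  let B := Matrix.toBilin' Q
  have hBs : B.IsSymm := by
    constructor
    intro x y
    simp only [B, Matrix.toBilin'_apply', RingHom.id_apply]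
    rw [Matrix.dotProduct_mulVec, ← Matrix.mulVec_transpose, hs, dotProduct_comm]
  have hnd : B.Nondegenerate := by
    apply Matrix.Nondegenerate.toBilin'
    exact Matrix.nondegenerate_of_det_ne_zero ((Matrix.isUnit_iff_isUnit_det _).1 hQ).ne_zero
  obtain ⟨b, hb⟩ := LinearMap.BilinForm.exists_orthogonal_basis (B := B) ⟨fun x y => hBs.eq x y⟩
  have hself : ∀ i, B (b i) (b i) ≠ 0 := fun i =>
    LinearMap.IsOrthoᵢ.not_isOrtho_basis_self_of_separatingLeft hb hnd.1 i
  have hsq : ∀ i, ∃ c : ℂ, c * c * B (b i) (b i) = 1 := by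
    intro i
    obtain ⟨c, hc⟩ := IsAlgClosed.exists_pow_nat_eq (B (b i) (b i))⁻¹ (n := 2) (by norm_num)
    exact ⟨c, by rw [← pow_two, hc, inv_mul_cancel₀ (hself i)]⟩
  choose c hc using hsq
  let e : Fin n ≃ Fin (Module.finrank ℂ (Fin n → ℂ)) := finCongr (by simp)
  refine ⟨Matrix.of fun x i => c (e i) * b (e i) x, ?_⟩
  have hcol : ∀ i j, ((Matrix.of fun x i => c (e i) * b (e i) x)ᵀ * Q *
      (Matrix.of fun x i => c (e i) * b (e i) x) : Matrix (Fin n) (Fin n) ℂ) i j =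
      c (e i) * c (e j) * B (b (e i)) (b (e j)) := by
    intro i j
    simp only [B, Matrix.toBilin'_apply, Matrix.mul_apply, Matrix.transpose_apply, Matrix.of_apply,
      Finset.sum_mul, Finset.mul_sum]
    rw [Finset.sum_comm]
    exact Finset.sum_congr rfl fun _ _ => Finset.sum_congr rfl fun _ _ => by ring
  ext i j
  rw [hcol, Matrix.one_apply]
  split_ifs with h
  · subst h; exact hc _
  · have := hb (e.injective.ne h)
    rw [show B (b (e i)) (b (e j)) = 0 from this, mul_zero]
def PhiG (m : ℕ) {X Z : Type} (P : Matrix X Z ℂ) : Matrix (Fin m → X) (Fin m → Z) ℂ :=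
  Matrix.of fun k q => ∏ i, P (k i) (q i)

theorem PhiMat_eq {N m : ℕ} (g : Matrix (Fin N) (Fin N) ℂ) :
    (PhiMat g : Matrix (Fin m → Fin N) (Fin m → Fin N) ℂ) = PhiG m g := rfl

theorem PhiG_mul {m : ℕ} {X Y Z : Type} [Fintype Y] (P : Matrix X Y ℂ) (R : Matrix Y Z ℂ) :
    (PhiG m (P * R) : Matrix (Fin m → X) (Fin m → Z) ℂ) = PhiG m P * PhiG m R := by
  ext k q
  rw [Matrix.mul_apply]
  simp only [PhiG, Matrix.mul_apply, Matrix.of_apply, Fintype.prod_sum, Finset.prod_mul_distrib]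

theorem PhiG_one {m : ℕ} {X : Type} [DecidableEq X] :
    (PhiG m 1 : Matrix (Fin m → X) (Fin m → X) ℂ) = 1 := by
  ext k q
  simp only [PhiG, Matrix.of_apply, Matrix.one_apply]
  by_cases h : k = q
  · subst h; simp
  · rw [if_neg h]
    obtain ⟨i, hi⟩ : ∃ i, k i ≠ q i := by
      by_contra! h'; exact h (funext h')
    exact Finset.prod_eq_zero (Finset.mem_univ i) (by simp [hi])

def BrauerSub (n l : ℕ) (Q : Matrix (Fin n) (Fin n) ℂ) :
    Submodule ℂ (Matrix (Fin l → Fin n) (Fin l → Fin n) ℂ) where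
  carrier := BrauerSet n l Q
  add_mem' := by
    intro A B hA hB g hg
    rw [mul_add, add_mul, hA g hg, hB g hg]
  zero_mem' := by intro g hg; simp
  smul_mem' := by
    intro c A hA g hg
    rw [Matrix.mul_smul, Matrix.smul_mul, hA g hg]

def sumE {l : ℕ} (X : Type) : Matrix (Fin l → X) (Fin l → X) ℂ ≃ₗ[ℂ] ((Fin l ⊕ Fin l → X) → ℂ) where
  toFun C s := C (fun k => s (Sum.inl k)) (fun k => s (Sum.inr k))
  invFun F := Matrix.of fun a b => F (Sum.elim a b)
  left_inv C := rfl
  right_inv F := by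
    funext s
    simp only [Matrix.of_apply]
    congr 1
    funext i
    rcases i with i | i <;> rfl
  map_add' _ _ := rfl
  map_smul' _ _ := rfl

theorem sumE_mem {l : ℕ} {X : Type} [Fintype X] [DecidableEq X] (Q : Matrix X X ℂ)
    (C : Matrix (Fin l → X) (Fin l → X) ℂ) :
    sumE X C ∈ InvSub l Q ↔ ∀ g : Matrix X X ℂ, gᵀ * Q * g = Q → PhiG l gᵀ * C * PhiG l g = C := by
  apply forall_congr'
  intro g
  apply imp_congr_right
  intro _
  have key : ∀ t : Fin l ⊕ Fin l → X, ∑ s : Fin l ⊕ Fin l → X, (∏ i, g (s i) (t i)) * sumE X C s =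
      sumE X (PhiG l gᵀ * C * PhiG l g) t := by
    intro t
    rw [← (Equiv.sumArrowEquivProdArrow (Fin l) (Fin l) X).symm.sum_comp, Fintype.sum_prod_type_right]
    change _ = (PhiG l gᵀ * C * PhiG l g) (fun k => t (Sum.inl k)) (fun k => t (Sum.inr k))
    rw [Matrix.mul_apply]
    simp only [Matrix.mul_apply, Finset.sum_mul]
    refine Finset.sum_congr rfl fun b _ => Finset.sum_congr rfl fun a _ => ?_
    rw [Fintype.prod_sum_type]
    simp only [PhiG, Matrix.of_apply, Equiv.sumArrowEquivProdArrow_symm_apply_inl,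
      Equiv.sumArrowEquivProdArrow_symm_apply_inr, Matrix.transpose_apply]
    change _ * C a b = _
    ring
  constructor
  · intro h
    apply (sumE X).injective
    funext t
    rw [← key, h t]
  · intro h t
    rw [key, h]

theorem finrank_brauer_of {n l : ℕ} {X : Type} [Fintype X] [DecidableEq X]
    (Q : Matrix (Fin n) (Fin n) ℂ) (P : Matrix (Fin n) X ℂ) (P' : Matrix X (Fin n) ℂ)
    (Q0 Q0' : Matrix X X ℂ) (h1 : P * P' = 1) (h2 : P' * P = 1) (h3 : Q0 * Q0' = 1)
    (hP : Pᵀ * Q * P = Q0) :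
    Module.finrank ℂ (BrauerSub n l Q) = Module.finrank ℂ (InvSub l Q0) := by
  have h4 : Q0' * Q0 = 1 := mul_eq_one_comm.1 h3
  let Θ0 : Matrix (Fin l → Fin n) (Fin l → Fin n) ℂ ≃ₗ[ℂ] Matrix (Fin l → X) (Fin l → X) ℂ :=
    { toFun := fun A => PhiG l (Q0 * P') * A * PhiG l P
      invFun := fun C => PhiG l (P * Q0') * C * PhiG l P'
      map_add' := fun A B => by rw [Matrix.mul_add, Matrix.add_mul]
      map_smul' := fun c A => by simp
      left_inv := fun A => by
        have : P * Q0' * (Q0 * P') = 1 := by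
          rw [Matrix.mul_assoc, ← Matrix.mul_assoc Q0', h4, Matrix.one_mul, h1]
        show PhiG l (P * Q0') * (PhiG l (Q0 * P') * A * PhiG l P) * PhiG l P' = A
        rw [Matrix.mul_assoc (PhiG l (Q0 * P')), ← Matrix.mul_assoc (PhiG l (P * Q0')), ← PhiG_mul,
          this, PhiG_one, Matrix.one_mul, Matrix.mul_assoc, ← PhiG_mul, h1, PhiG_one, Matrix.mul_one]
      right_inv := fun C => by
        have : Q0 * P' * (P * Q0') = 1 := by
          rw [Matrix.mul_assoc, ← Matrix.mul_assoc P', h2, Matrix.one_mul, h3]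
        show PhiG l (Q0 * P') * (PhiG l (P * Q0') * C * PhiG l P') * PhiG l P = C
        rw [Matrix.mul_assoc (PhiG l (P * Q0')), ← Matrix.mul_assoc (PhiG l (Q0 * P')), ← PhiG_mul,
          this, PhiG_one, Matrix.one_mul, Matrix.mul_assoc, ← PhiG_mul, h2, PhiG_one, Matrix.mul_one] }
  have hΘ : ∀ A, Θ0 A = PhiG l (Q0 * P') * A * PhiG l P := fun _ => rfl
  let Θ := Θ0.trans (sumE X)
  have hP' : P'ᵀ * Q0 * P' = Q := by
    rw [← hP]
    calc P'ᵀ * (Pᵀ * Q * P) * P' = (P'ᵀ * Pᵀ) * Q * (P * P') := by simp only [Matrix.mul_assoc]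
      _ = Q := by rw [← Matrix.transpose_mul, h1]; simp
  have hmem : ∀ A, A ∈ BrauerSub n l Q ↔ Θ A ∈ InvSub l Q0 := by
    intro A
    rw [show Θ A = sumE X (Θ0 A) from rfl, sumE_mem]
    constructor
    · intro hA g0 hg0
      have hg : (P * g0 * P')ᵀ * Q * (P * g0 * P') = Q := by
        calc (P * g0 * P')ᵀ * Q * (P * g0 * P') = P'ᵀ * (g0ᵀ * (Pᵀ * Q * P) * g0) * P' := by
              simp only [Matrix.transpose_mul, Matrix.mul_assoc]
          _ = Q := by rw [hP, hg0, hP']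
      have hc := hA _ hg
      rw [PhiMat_eq] at hc
      rw [hΘ]
      have e1 : P * g0 = (P * g0 * P') * P := by
        rw [Matrix.mul_assoc _ P', h2, Matrix.mul_one]
      have e2 : g0ᵀ * (Q0 * P') * (P * g0 * P') = Q0 * P' := by
        calc g0ᵀ * (Q0 * P') * (P * g0 * P') = g0ᵀ * Q0 * (P' * P) * g0 * P' := by
              simp only [Matrix.mul_assoc]
          _ = Q0 * P' := by rw [h2, Matrix.mul_one, hg0]
      calc PhiG l g0ᵀ * (PhiG l (Q0 * P') * A * PhiG l P) * PhiG l g0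
          = PhiG l (g0ᵀ * (Q0 * P')) * A * PhiG l (P * g0) := by
            simp only [PhiG_mul, Matrix.mul_assoc]
        _ = PhiG l (g0ᵀ * (Q0 * P')) * (A * PhiG l (P * g0 * P')) * PhiG l P := by
            rw [e1, PhiG_mul _ P, ← e1]; simp only [Matrix.mul_assoc]
        _ = PhiG l (g0ᵀ * (Q0 * P') * (P * g0 * P')) * A * PhiG l P := by
            rw [← hc, PhiG_mul (g0ᵀ * (Q0 * P'))]; simp only [Matrix.mul_assoc]
        _ = _ := by rw [e2]
    · intro hA g hg
      rw [PhiMat_eq]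
      have hg0 : (P' * g * P)ᵀ * Q0 * (P' * g * P) = Q0 := by
        calc (P' * g * P)ᵀ * Q0 * (P' * g * P) = Pᵀ * (gᵀ * (P'ᵀ * Q0 * P') * g) * P := by
              simp only [Matrix.transpose_mul, Matrix.mul_assoc]
          _ = Q0 := by rw [hP', hg, hP]
      have hc := hA _ hg0
      rw [hΘ] at hc
      generalize hg0' : P' * g * P = g0 at *
      have e1 : P * g0 = g * P := by
        rw [← hg0', ← Matrix.mul_assoc, ← Matrix.mul_assoc, h1, Matrix.one_mul]
      have e3 : g0 * P' = P' * g := by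
        rw [← hg0', Matrix.mul_assoc, h1, Matrix.mul_one]
      have e2 : g0ᵀ * (Q0 * P') * g = Q0 * P' := by
        calc g0ᵀ * (Q0 * P') * g = g0ᵀ * Q0 * (P' * g) := by simp only [Matrix.mul_assoc]
          _ = g0ᵀ * Q0 * g0 * P' := by rw [← e3]; simp only [Matrix.mul_assoc]
          _ = Q0 * P' := by rw [hg0]
      have e4 : (Q0' * g0ᵀ * Q0) * g0 = 1 := by
        rw [Matrix.mul_assoc, Matrix.mul_assoc, ← Matrix.mul_assoc g0ᵀ, hg0, h4]
      have e5 : g0 * (Q0' * g0ᵀ * Q0) = 1 := mul_eq_one_comm.1 e4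
      have e6 : (P * g0 * Q0') * (g0ᵀ * (Q0 * P')) = 1 := by
        calc (P * g0 * Q0') * (g0ᵀ * (Q0 * P')) = P * (g0 * (Q0' * g0ᵀ * Q0)) * P' := by
              simp only [Matrix.mul_assoc]
          _ = 1 := by rw [e5, Matrix.mul_one, h1]
      have hc2 : PhiG l (g0ᵀ * (Q0 * P')) * (A * PhiG l g) * PhiG l P =
          PhiG l (g0ᵀ * (Q0 * P')) * (PhiG l g * A) * PhiG l P := by
        calc PhiG l (g0ᵀ * (Q0 * P')) * (A * PhiG l g) * PhiG l P
            = PhiG l (g0ᵀ * (Q0 * P')) * A * PhiG l (g * P) := by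
              simp only [PhiG_mul, Matrix.mul_assoc]
          _ = PhiG l g0ᵀ * (PhiG l (Q0 * P') * A * PhiG l P) * PhiG l g0 := by
              rw [← e1]; simp only [PhiG_mul, Matrix.mul_assoc]
          _ = PhiG l (g0ᵀ * (Q0 * P') * g) * A * PhiG l P := by rw [hc, e2]
          _ = _ := by rw [PhiG_mul _ g]; simp only [Matrix.mul_assoc]
      have hc3 := congrArg (fun M => PhiG l (P * g0 * Q0') * M * PhiG l P') hc2
      have red : ∀ M : Matrix (Fin l → Fin n) (Fin l → Fin n) ℂ,
          PhiG l (P * g0 * Q0') * (PhiG l (g0ᵀ * (Q0 * P')) * M * PhiG l P) * PhiG l P' = M := by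
        intro M
        rw [Matrix.mul_assoc (PhiG l (g0ᵀ * (Q0 * P'))), ← Matrix.mul_assoc (PhiG l (P * g0 * Q0')),
          ← PhiG_mul, e6, PhiG_one, Matrix.one_mul, Matrix.mul_assoc, ← PhiG_mul, h1, PhiG_one,
          Matrix.mul_one]
      simp only [red] at hc3
      exact hc3.symm
  have hmap : (BrauerSub n l Q).map Θ.toLinearMap = InvSub l Q0 := by
    ext F
    rw [Submodule.mem_map]
    constructor
    · rintro ⟨A, hA, rfl⟩
      exact (hmem A).1 hA
    · intro hF
      refine ⟨Θ.symm F, (hmem _).2 ?_, ?_⟩ <;> simp [hF]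
  rw [← hmap]
  exact (LinearEquiv.finrank_map_eq Θ _).symm

theorem finrank_brauer {n l : ℕ} (hn : 2 * l ≤ n) (Q : Matrix (Fin n) (Fin n) ℂ) (hQ : IsUnit Q)
    (hform : Qᵀ = Q ∨ Qᵀ = -Q) :
    Module.finrank ℂ (BrauerSub n l Q) = Nat.doubleFactorial (2 * l - 1) := by
  rcases hform with hs | hs
  · obtain ⟨P, hP⟩ := exists_orth Q hQ hs
    have hinv : (Pᵀ * Q) * P = 1 := hP
    have hinv' : P * (Pᵀ * Q) = 1 := mul_eq_one_comm.1 hinv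
    have hQT : QT (Fin n) (1 : Matrix Unit Unit ℂ) = 1 := by
      ext ⟨x, a⟩ ⟨y, b⟩
      simp [QT, Matrix.one_apply]
    rw [← finrank_Inv_unit (l := l) (Y := Fin n) (by simp; omega)]
    let e : Fin n × Unit ≃ Fin n := Equiv.prodPUnit _
    refine finrank_brauer_of Q (P.submatrix id e) ((Pᵀ * Q).submatrix e id) _ 1 ?_ ?_ ?_ ?_
    · rw [Matrix.submatrix_mul_equiv, hinv']; simp
    · rw [← Matrix.submatrix_mul _ _ _ _ _ Function.bijective_id, hinv, Matrix.submatrix_one_equiv]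
    · rw [hQT, mul_one]
    · rw [hQT, Matrix.transpose_submatrix]
      have : Q = Q.submatrix id id := rfl
      conv_lhs => rw [this]
      rw [← Matrix.submatrix_mul _ _ _ _ _ Function.bijective_id,
        ← Matrix.submatrix_mul _ _ _ _ _ Function.bijective_id, hP, Matrix.submatrix_one_equiv]
  · have hdet : Q.det ≠ 0 := ((Matrix.isUnit_iff_isUnit_det _).1 hQ).ne_zero
    have heven : Even n := by
      by_contra hodd
      rw [Nat.not_even_iff_odd] at hodd
      have h1 := Matrix.det_transpose Q
      rw [hs, Matrix.det_neg, Fintype.card_fin, hodd.neg_one_pow] at h1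
      exact hdet (by linear_combination (-1/2) * h1)
    obtain ⟨h, hh⟩ := heven
    obtain ⟨v, hv⟩ := exists_sympl (Matrix.toBilin' Q) (by
        intro x
        have h1 : x ⬝ᵥ Q *ᵥ x = - (x ⬝ᵥ Q *ᵥ x) := by
          conv_lhs => rw [Matrix.dotProduct_mulVec, ← Matrix.mulVec_transpose, hs, dotProduct_comm,
            Matrix.neg_mulVec, dotProduct_neg]
        rw [Matrix.toBilin'_apply']
        linear_combination (1/2) * h1)
      (by
        intro x hx
        apply Matrix.eq_zero_of_vecMul_eq_zero hdet
        funext y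
        have := hx (Pi.single y 1)
        rw [Matrix.toBilin'_apply', Matrix.dotProduct_mulVec] at this
        simpa using this) h (by simp; omega)
    rw [← finrank_Inv_bool (l := l) (Y := Fin h) (by simp; omega)]
    let P : Matrix (Fin n) (Fin h × Bool) ℂ := Matrix.of fun i x => v x i
    have hP : Pᵀ * Q * P = QT (Fin h) qSp := by
      ext x y
      rw [← hv x y, Matrix.toBilin'_apply]
      simp only [Matrix.mul_apply, Finset.sum_mul, P, Matrix.transpose_apply, Matrix.of_apply]
      rw [Finset.sum_comm]
    have h3 : QT (Fin h) qSp * (- QT (Fin h) qSp) = 1 := by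
      ext ⟨x, a⟩ ⟨y, b⟩
      rw [Matrix.mul_apply, Fintype.sum_prod_type, Finset.sum_eq_single x]
      · by_cases hxy : x = y
        · subst hxy
          cases a <;> cases b <;> simp [QT, qSp]
        · simp [QT, hxy, Matrix.one_apply]
      · intro z _ hz
        simp [QT, hz.symm]
      · simp
    have hl : ((- QT (Fin h) qSp) * (Pᵀ * Q)) * P = 1 := by
      rw [Matrix.mul_assoc, hP]; exact mul_eq_one_comm.1 h3
    have hr := (Matrix.mul_eq_one_comm_of_card_eq _ _ _ (by simp; omega)).1 hl
    exact finrank_brauer_of Q P _ _ _ hr hl h3 hP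
def supp {n r : ℕ} (k : Fin r → Fin (n + 1)) : Finset (Fin r) :=
  Finset.univ.filter fun i => k i ≠ Fin.last n

theorem mem_supp {n r : ℕ} (k : Fin r → Fin (n + 1)) (i : Fin r) :
    i ∈ supp k ↔ k i ≠ Fin.last n := by simp [supp]

theorem levelOf_eq {n r : ℕ} (k : Fin r → Fin (n + 1)) : levelOf k = (supp k).card := rfl

theorem emb_mem {n r l : ℕ} {I : Finset (Fin r)} (hI : I.card = l) (a : Fin l → Fin n)
    {i : Fin r} (h : i ∈ I) :
    emb I hI a i = Fin.castSucc (a ((I.orderIsoOfFin hI).symm ⟨i, h⟩)) := by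
  simp [emb, h]

theorem emb_notMem {n r l : ℕ} {I : Finset (Fin r)} (hI : I.card = l) (a : Fin l → Fin n)
    {i : Fin r} (h : i ∉ I) : emb I hI a i = Fin.last n := by
  simp [emb, h]

theorem supp_emb {n r l : ℕ} (I : Finset (Fin r)) (hI : I.card = l) (a : Fin l → Fin n) :
    supp (emb I hI a) = I := by
  ext i
  rw [mem_supp]
  by_cases h : i ∈ I
  · simp [emb_mem hI a h, h, Fin.castSucc_ne_last]
  · simp [emb_notMem hI a h, h]

theorem level_emb {n r l : ℕ} (I : Finset (Fin r)) (hI : I.card = l) (a : Fin l → Fin n) :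
    levelOf (emb I hI a) = l := by rw [levelOf_eq, supp_emb, hI]

theorem emb_inj {n r l : ℕ} (I : Finset (Fin r)) (hI : I.card = l) :
    Function.Injective (emb (n := n) I hI) := by
  intro a b h
  funext j
  have h1 := congrFun h (I.orderIsoOfFin hI j)
  rw [emb_mem hI a (Subtype.coe_prop _), emb_mem hI b (Subtype.coe_prop _)] at h1
  have h2 := Fin.castSucc_injective _ h1
  simp only [Subtype.coe_eta, OrderIso.symm_apply_apply] at h2
  exact h2

theorem exists_emb {n r l : ℕ} (I : Finset (Fin r)) (hI : I.card = l) (k : Fin r → Fin (n + 1))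
    (hk : supp k = I) : ∃ a, k = emb I hI a := by
  subst hk
  refine ⟨fun j => (k ((supp k).orderIsoOfFin hI j)).castPred ((mem_supp k _).1 (Subtype.coe_prop _)), ?_⟩
  funext i
  by_cases h : i ∈ supp k
  · rw [emb_mem hI _ h]; simp
  · rw [emb_notMem hI _ h]
    by_contra h2
    exact h ((mem_supp k i).2 h2)

theorem sum_emb {n r : ℕ} (f : (Fin r → Fin (n + 1)) → ℂ) :
    ∑ k, f k = ∑ I : Finset (Fin r), ∑ a : Fin I.card → Fin n, f (emb I rfl a) := by
  let φ : (Σ I : Finset (Fin r), (Fin I.card → Fin n)) → (Fin r → Fin (n + 1)) :=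
    fun p => emb p.1 rfl p.2
  have hφ : Function.Bijective φ := by
    constructor
    · rintro ⟨I, a⟩ ⟨J, b⟩ h
      have h1 : I = J := by
        have := congrArg supp h
        simpa only [φ, supp_emb] using this
      subst h1
      have := emb_inj I rfl h
      simpa using this
    · intro k
      obtain ⟨a, ha⟩ := exists_emb (supp k) rfl k rfl
      exact ⟨⟨supp k, a⟩, ha.symm⟩
  rw [← (Equiv.ofBijective φ hφ).sum_comp, Fintype.sum_sigma]
  rfl

noncomputable def opMat2 {n r l : ℕ} (I J : Finset (Fin r)) (hI : I.card = l) (hJ : J.card = l)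
    (A : Matrix (Fin l → Fin n) (Fin l → Fin n) ℂ) :
    Matrix (Fin r → Fin (n + 1)) (Fin r → Fin (n + 1)) ℂ :=
  fun k q => ∑ a : Fin l → Fin n, ∑ b : Fin l → Fin n,
    if k = emb I hI a ∧ q = emb J hJ b then A a b else 0

theorem opMat2_emb {n r l : ℕ} (I J : Finset (Fin r)) (hI : I.card = l) (hJ : J.card = l)
    (A : Matrix (Fin l → Fin n) (Fin l → Fin n) ℂ) (a b) :
    opMat2 I J hI hJ A (emb I hI a) (emb J hJ b) = A a b := by
  unfold opMat2
  rw [Finset.sum_eq_single a, Finset.sum_eq_single b]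
  · simp
  · intro b' _ hb
    rw [if_neg]
    rintro ⟨_, h⟩
    exact hb (emb_inj J hJ h).symm
  · simp
  · intro a' _ ha
    refine Finset.sum_eq_zero fun b' _ => ?_
    rw [if_neg]
    rintro ⟨h, _⟩
    exact ha (emb_inj I hI h).symm
  · simp

theorem opMat2_ne {n r l : ℕ} (I J : Finset (Fin r)) (hI : I.card = l) (hJ : J.card = l)
    (A : Matrix (Fin l → Fin n) (Fin l → Fin n) ℂ) (k q) (h : ¬ (supp k = I ∧ supp q = J)) :
    opMat2 I J hI hJ A k q = 0 := by
  unfold opMat2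
  refine Finset.sum_eq_zero fun a _ => Finset.sum_eq_zero fun b _ => ?_
  rw [if_neg]
  rintro ⟨rfl, rfl⟩
  exact h ⟨supp_emb _ _ _, supp_emb _ _ _⟩

def PsiS {n r : ℕ} (S : ℕ → Prop) [DecidablePred S] (s : Equiv.Perm (Fin r)) :
    Matrix (Fin r → Fin (n + 1)) (Fin r → Fin (n + 1)) ℂ :=
  fun k q => if S (levelOf (n := n) k) ∧ q = k ∘ s then 1 else 0

def LS (n r : ℕ) (S : ℕ → Prop) (Q : Matrix (Fin n) (Fin n) ℂ) :
    Submodule ℂ (Matrix (Fin r → Fin (n + 1)) (Fin r → Fin (n + 1)) ℂ) where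
  carrier := {M | (∀ k q, ¬ (levelOf k = levelOf q ∧ S (levelOf k)) → M k q = 0) ∧
    ∀ l (I J : Finset (Fin r)) (hI : I.card = l) (hJ : J.card = l),
      M.submatrix (emb I hI) (emb J hJ) ∈ BrauerSub n l Q}
  add_mem' := by
    rintro M N ⟨h1, h2⟩ ⟨h3, h4⟩
    refine ⟨fun k q h => ?_, fun l I J hI hJ => ?_⟩
    · rw [Matrix.add_apply, h1 k q h, h3 k q h, add_zero]
    · exact (BrauerSub n l Q).add_mem (h2 l I J hI hJ) (h4 l I J hI hJ)
  zero_mem' := ⟨fun _ _ _ => rfl, fun l I J hI hJ => (BrauerSub n l Q).zero_mem⟩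
  smul_mem' := by
    rintro c M ⟨h1, h2⟩
    refine ⟨fun k q h => ?_, fun l I J hI hJ => ?_⟩
    · rw [Matrix.smul_apply, h1 k q h, smul_zero]
    · exact (BrauerSub n l Q).smul_mem c (h2 l I J hI hJ)

theorem brauer_mul {n l : ℕ} {Q : Matrix (Fin n) (Fin n) ℂ}
    {A B : Matrix (Fin l → Fin n) (Fin l → Fin n) ℂ}
    (hA : A ∈ BrauerSub n l Q) (hB : B ∈ BrauerSub n l Q) : A * B ∈ BrauerSub n l Q := by
  intro g hg
  rw [← Matrix.mul_assoc, hA g hg, Matrix.mul_assoc, hB g hg, Matrix.mul_assoc]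

theorem LS_mul {n r : ℕ} {S : ℕ → Prop} {Q : Matrix (Fin n) (Fin n) ℂ}
    {M N : Matrix (Fin r → Fin (n + 1)) (Fin r → Fin (n + 1)) ℂ}
    (hM : M ∈ LS n r S Q) (hN : N ∈ LS n r S Q) : M * N ∈ LS n r S Q := by
  constructor
  · intro k q h
    rw [Matrix.mul_apply]
    refine Finset.sum_eq_zero fun c _ => ?_
    by_cases h1 : levelOf k = levelOf c ∧ S (levelOf k)
    · rw [hN.1 c q, mul_zero]
      rw [← h1.1]; exact h
    · rw [hM.1 k c h1, zero_mul]
  · intro l I J hI hJ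
    have : (M * N).submatrix (emb I hI) (emb J hJ) = ∑ K : Finset (Fin r),
        M.submatrix (emb I hI) (emb K rfl) * N.submatrix (emb K rfl) (emb J hJ) := by
      ext a b
      rw [Matrix.submatrix_apply, Matrix.mul_apply, sum_emb, Matrix.sum_apply]
      rfl
    rw [this]
    refine Submodule.sum_mem _ fun K _ => ?_
    by_cases hK : K.card = l
    · subst hK
      exact brauer_mul (hM.2 _ I K hI rfl) (hN.2 _ K J rfl hJ)
    · have : M.submatrix (emb I hI) (emb K rfl) = 0 := by
        ext a c
        apply hM.1
        rw [level_emb, level_emb]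
        exact fun h => hK h.1.symm
      rw [this, Matrix.zero_mul]
      exact Submodule.zero_mem _

theorem psi_brauer {n l : ℕ} {Q : Matrix (Fin n) (Fin n) ℂ} (t : Equiv.Perm (Fin l)) :
    PsiMat t ∈ BrauerSub n l Q := by
  intro g hg
  ext k q
  rw [Matrix.mul_apply, Matrix.mul_apply]
  simp only [PsiMat, PhiMat, mul_ite, mul_one, mul_zero, ite_mul, one_mul, zero_mul]
  rw [Finset.sum_ite_eq' Finset.univ (k ∘ t), if_pos (Finset.mem_univ _)]
  rw [Finset.sum_eq_single (q ∘ t.symm)]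
  · rw [if_pos (by ext; simp), ← Equiv.prod_comp t]
    simp
  · intro c _ hc
    rw [if_neg]
    rintro rfl
    exact hc (by ext; simp)
  · simp

theorem emb_comp {n r l : ℕ} (I J : Finset (Fin r)) (hI : I.card = l) (hJ : J.card = l)
    (s : Equiv.Perm (Fin r)) (h : ∀ i, i ∈ J ↔ s i ∈ I) :
    ∃ t : Equiv.Perm (Fin l), ∀ a : Fin l → Fin n, emb I hI a ∘ s = emb J hJ (a ∘ t) := by
  refine ⟨(J.orderIsoOfFin hJ).toEquiv.trans ((s.subtypeEquiv h).trans
    (I.orderIsoOfFin hI).symm.toEquiv), fun a => ?_⟩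
  funext i
  by_cases hi : i ∈ J
  · rw [emb_mem hJ _ hi, Function.comp_apply, emb_mem hI _ ((h i).1 hi)]
    simp
  · rw [emb_notMem hJ _ hi, Function.comp_apply, emb_notMem hI _ (fun h' => hi ((h i).2 h'))]

theorem level_comp {n r : ℕ} (k : Fin r → Fin (n + 1)) (s : Equiv.Perm (Fin r)) :
    levelOf (k ∘ s) = levelOf k := by
  rw [levelOf_eq, levelOf_eq]
  refine Finset.card_bij (fun i _ => s i) ?_ ?_ ?_
  · intro i hi; rw [mem_supp] at *; exact hi
  · intro i _ j _ h; exact s.injective h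
  · intro j hj
    refine ⟨s.symm j, ?_, by simp⟩
    rw [mem_supp] at *; simpa using hj

theorem PsiS_mem {n r : ℕ} {S : ℕ → Prop} [DecidablePred S] {Q : Matrix (Fin n) (Fin n) ℂ}
    (s : Equiv.Perm (Fin r)) : PsiS S s ∈ LS n r S Q := by
  constructor
  · intro k q h
    unfold PsiS
    rw [if_neg]
    rintro ⟨h1, rfl⟩
    exact h ⟨(level_comp k s).symm, h1⟩
  · intro l I J hI hJ
    by_cases hc : S l ∧ ∀ i, i ∈ J ↔ s i ∈ I
    · obtain ⟨t, ht⟩ := emb_comp (n := n) I J hI hJ s hc.2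
      have : (PsiS S s).submatrix (emb I hI) (emb J hJ) =
          (PsiMat t : Matrix (Fin l → Fin n) (Fin l → Fin n) ℂ) := by
        ext a b
        simp only [Matrix.submatrix_apply, PsiS, PsiMat, level_emb, hc.1, true_and, ht,
          (emb_inj J hJ).eq_iff]
      rw [this]
      exact psi_brauer t
    · have : (PsiS S s).submatrix (emb I hI) (emb J hJ) =
          (0 : Matrix (Fin l → Fin n) (Fin l → Fin n) ℂ) := by
        ext a b
        simp only [Matrix.submatrix_apply, PsiS, level_emb, Matrix.zero_apply]
        rw [if_neg]
        rintro ⟨h1, h2⟩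
        refine hc ⟨h1, fun i => ?_⟩
        rw [← supp_emb J hJ b, mem_supp, h2, Function.comp_apply, ← mem_supp, supp_emb]
      rw [this]
      exact Submodule.zero_mem _

theorem opMat2_mem {n r l : ℕ} {S : ℕ → Prop} {Q : Matrix (Fin n) (Fin n) ℂ}
    (I J : Finset (Fin r)) (hI : I.card = l) (hJ : J.card = l) (hl : S l)
    (A : Matrix (Fin l → Fin n) (Fin l → Fin n) ℂ) (hA : A ∈ BrauerSub n l Q) :
    opMat2 I J hI hJ A ∈ LS n r S Q := by
  constructor
  · intro k q h
    apply opMat2_ne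
    rintro ⟨h1, h2⟩
    rw [levelOf_eq, levelOf_eq, h1, h2, hI, hJ] at h
    exact h ⟨rfl, hl⟩
  · intro l' I' J' hI' hJ'
    by_cases hc : I' = I ∧ J' = J
    · obtain ⟨rfl, rfl⟩ := hc
      obtain rfl : l' = l := hI'.symm.trans hI
      have : (opMat2 I' J' hI hJ A).submatrix (emb I' hI') (emb J' hJ') = A := by
        ext a b
        exact opMat2_emb _ _ _ _ _ _ _
      rw [this]; exact hA
    · have : (opMat2 I J hI hJ A).submatrix (emb I' hI') (emb J' hJ') = 0 := by
        ext a b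
        apply opMat2_ne
        rw [supp_emb, supp_emb]
        exact hc
      rw [this]
      exact Submodule.zero_mem _

theorem opMat2_eq {n r l : ℕ} {S : ℕ → Prop} [DecidablePred S]
    (I J : Finset (Fin r)) (hI : I.card = l) (hJ : J.card = l) (hl : S l)
    (A : Matrix (Fin l → Fin n) (Fin l → Fin n) ℂ) :
    ∃ s : Equiv.Perm (Fin r), opMat2 I J hI hJ A = opMat I hI A * PsiS S s := by
  let e : {x // x ∈ J} ≃ {x // x ∈ I} :=
    (J.orderIsoOfFin hJ).symm.toEquiv.trans (I.orderIsoOfFin hI).toEquiv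
  have hs : ∀ a : Fin l → Fin n, emb I hI a ∘ e.extendSubtype = emb J hJ a := by
    intro a
    funext i
    by_cases hi : i ∈ J
    · rw [emb_mem hJ _ hi, Function.comp_apply, emb_mem hI _ (e.extendSubtype_mem i hi)]
      congr 2
      rw [OrderIso.symm_apply_eq]
      apply Subtype.ext
      exact e.extendSubtype_apply_of_mem i hi
    · rw [emb_notMem hJ _ hi, Function.comp_apply, emb_notMem hI _ (e.extendSubtype_not_mem i hi)]
  refine ⟨e.extendSubtype, ?_⟩
  ext k q
  rw [Matrix.mul_apply]
  simp only [opMat, opMat2, Finset.sum_mul]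
  refine Eq.trans ?_ Finset.sum_comm
  refine Finset.sum_congr rfl fun a _ => ?_
  refine Eq.trans ?_ Finset.sum_comm
  refine Finset.sum_congr rfl fun b _ => ?_
  rw [Finset.sum_eq_single (emb I hI b)]
  · simp only [PsiS, level_emb, hl, true_and, hs, and_true]
    by_cases h1 : k = emb I hI a <;> by_cases h2 : q = emb J hJ b <;> simp [h1, h2]
  · intro c _ hc
    simp [hc]
  · simp

abbrev PI (r : ℕ) (S : ℕ → Prop) : Type :=
  {p : Finset (Fin r) × Finset (Fin r) // p.2.card = p.1.card ∧ S p.1.card}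

noncomputable instance (r : ℕ) (S : ℕ → Prop) : Fintype (PI r S) := by
  classical exact inferInstance

theorem LS_decomp {n r : ℕ} {S : ℕ → Prop} {Q : Matrix (Fin n) (Fin n) ℂ}
    {M : Matrix (Fin r → Fin (n + 1)) (Fin r → Fin (n + 1)) ℂ} (hM : M ∈ LS n r S Q) :
    M = ∑ p : PI r S, opMat2 p.1.1 p.1.2 rfl p.2.1
      (M.submatrix (emb p.1.1 rfl) (emb p.1.2 p.2.1)) := by
  ext k q
  rw [Matrix.sum_apply]
  by_cases h : levelOf k = levelOf q ∧ S (levelOf k)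
  · rw [Finset.sum_eq_single (⟨(supp k, supp q), h.1.symm, h.2⟩ : PI r S)]
    · obtain ⟨a, ha⟩ := exists_emb (supp k) rfl k rfl
      have hc : (supp q).card = (supp k).card := h.1.symm
      obtain ⟨b, hb⟩ := exists_emb (supp q) hc q rfl
      have := opMat2_emb (supp k) (supp q) rfl hc
        (M.submatrix (emb (supp k) rfl) (emb (supp q) hc)) a b
      rw [← ha, ← hb, Matrix.submatrix_apply, ← ha, ← hb] at this
      exact this.symm
    · intro p _ hp
      apply opMat2_ne
      rintro ⟨h1, h2⟩
      exact hp (Subtype.ext (Prod.ext h1.symm h2.symm))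
    · simp
  · rw [hM.1 k q h, Finset.sum_eq_zero]
    intro p _
    apply opMat2_ne
    rintro ⟨h1, h2⟩
    rw [levelOf_eq, levelOf_eq, h1, h2] at h
    exact h ⟨p.2.1.symm, p.2.2⟩

theorem adjoin_eq {n r : ℕ} (S : ℕ → Prop) [DecidablePred S] (Q : Matrix (Fin n) (Fin n) ℂ)
    (G : Set (Matrix (Fin r → Fin (n + 1)) (Fin r → Fin (n + 1)) ℂ))
    (hG : ∀ M, M ∈ G ↔ (∃ s : Equiv.Perm (Fin r), M = PsiS S s) ∨
      (∃ I : Finset (Fin r), S I.card ∧ ∃ A ∈ BrauerSet n I.card Q, M = opMat I rfl A)) :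
    (NonUnitalAlgebra.adjoin ℂ G).toSubmodule = LS n r S Q := by
  ext M
  rw [NonUnitalSubalgebra.mem_toSubmodule]
  constructor
  · intro hM
    induction hM using NonUnitalAlgebra.adjoin_induction with
    | mem x hx =>
      rcases (hG x).1 hx with ⟨s, rfl⟩ | ⟨I, hI, A, hA, rfl⟩
      · exact PsiS_mem s
      · exact opMat2_mem I I rfl rfl hI A hA
    | add x y _ _ hx hy => exact Submodule.add_mem _ hx hy
    | zero => exact Submodule.zero_mem _
    | mul x y _ _ hx hy => exact LS_mul hx hy
    | smul c x _ hx => exact Submodule.smul_mem _ c hx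
  · intro hM
    rw [LS_decomp hM]
    refine sum_mem fun p _ => ?_
    obtain ⟨s, hs⟩ := opMat2_eq (S := S) p.1.1 p.1.2 rfl p.2.1 p.2.2
      (M.submatrix (emb p.1.1 rfl) (emb p.1.2 p.2.1))
    rw [hs]
    refine mul_mem ?_ ?_
    · exact NonUnitalAlgebra.subset_adjoin ℂ ((hG _).2 (Or.inr ⟨_, p.2.2, _, hM.2 _ _ _ _ _, rfl⟩))
    · exact NonUnitalAlgebra.subset_adjoin ℂ ((hG _).2 (Or.inl ⟨s, rfl⟩))

theorem finrank_LS {n r : ℕ} (S : ℕ → Prop) [DecidablePred S] (hn : 2 * r ≤ n)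
    (Q : Matrix (Fin n) (Fin n) ℂ) (hQ : IsUnit Q) (hform : Qᵀ = Q ∨ Qᵀ = -Q) :
    Module.finrank ℂ (LS n r S Q) = ∑ l ∈ Finset.range (r + 1),
      if S l then (r.choose l) ^ 2 * Nat.doubleFactorial (2 * l - 1) else 0 := by
  let Θ : LS n r S Q →ₗ[ℂ] ((p : PI r S) → BrauerSub n p.1.1.card Q) :=
    { toFun := fun M p => ⟨M.1.submatrix (emb p.1.1 rfl) (emb p.1.2 p.2.1), M.2.2 _ _ _ _ _⟩
      map_add' := fun _ _ => rfl
      map_smul' := fun _ _ => rfl }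
  have hΘ : Function.Bijective Θ := by
    constructor
    · rintro ⟨M, hM⟩ ⟨N, hN⟩ h
      apply Subtype.ext
      change M = N
      rw [LS_decomp hM, LS_decomp hN]
      refine Finset.sum_congr rfl fun p _ => ?_
      have : M.submatrix (emb p.1.1 rfl) (emb p.1.2 p.2.1) =
        N.submatrix (emb p.1.1 rfl) (emb p.1.2 p.2.1) := congrArg Subtype.val (congrFun h p)
      rw [this]
    · intro F
      refine ⟨⟨∑ p : PI r S, opMat2 p.1.1 p.1.2 rfl p.2.1 (F p).1, Submodule.sum_mem _ fun p _ =>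
        opMat2_mem _ _ _ _ p.2.2 _ (F p).2⟩, ?_⟩
      funext p
      apply Subtype.ext
      ext a b
      change (∑ p : PI r S, opMat2 p.1.1 p.1.2 rfl p.2.1 (F p).1) (emb p.1.1 rfl a)
        (emb p.1.2 p.2.1 b) = (F p).1 a b
      rw [Matrix.sum_apply, Finset.sum_eq_single p]
      · exact opMat2_emb _ _ _ _ _ _ _
      · intro p' _ hp
        apply opMat2_ne
        rw [supp_emb, supp_emb]
        rintro ⟨h1, h2⟩
        exact hp (Subtype.ext (Prod.ext h1.symm h2.symm))
      · simp
  rw [(LinearEquiv.ofBijective Θ hΘ).finrank_eq, Module.finrank_pi_fintype]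
  have h1 : ∀ p : PI r S, Module.finrank ℂ (BrauerSub n p.1.1.card Q) =
      Nat.doubleFactorial (2 * p.1.1.card - 1) := by
    intro p
    apply finrank_brauer _ Q hQ hform
    have := Finset.card_le_univ p.1.1
    rw [Fintype.card_fin] at this
    omega
  rw [Finset.sum_congr rfl fun p _ => h1 p]
  have hc : ∀ f : ℕ → ℕ, ∑ I : Finset (Fin r), f I.card =
      ∑ m ∈ Finset.range (r + 1), r.choose m * f m := by
    intro f
    have := Finset.sum_powerset_apply_card f (x := (Finset.univ : Finset (Fin r)))
    simpa using this
  have h2 : ∑ p : PI r S, Nat.doubleFactorial (2 * p.1.1.card - 1) =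
      ∑ p : Finset (Fin r) × Finset (Fin r), if p.2.card = p.1.card ∧ S p.1.card then
        Nat.doubleFactorial (2 * p.1.card - 1) else 0 := by
    rw [← Finset.sum_filter]
    exact (Finset.sum_subtype _ (fun p => by simp) (fun p : Finset (Fin r) × Finset (Fin r) =>
      Nat.doubleFactorial (2 * p.1.card - 1))).symm
  rw [h2, Fintype.sum_prod_type]
  have h3 : ∀ I : Finset (Fin r), (∑ J : Finset (Fin r), if J.card = I.card ∧ S I.card then
        Nat.doubleFactorial (2 * I.card - 1) else 0) =
      if S I.card then r.choose I.card * Nat.doubleFactorial (2 * I.card - 1) else 0 := by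
    intro I
    rw [hc (fun m => if m = I.card ∧ S I.card then Nat.doubleFactorial (2 * I.card - 1) else 0)]
    have := Finset.card_le_univ I
    rw [Fintype.card_fin] at this
    rw [Finset.sum_eq_single I.card]
    · simp
    · intro m _ hm; simp [hm]
    · intro h; exact absurd (Finset.mem_range.2 (by omega)) h
  simp only [h3]
  rw [hc (fun m => if S m then r.choose m * Nat.doubleFactorial (2 * m - 1) else 0)]
  refine Finset.sum_congr rfl fun m _ => ?_
  split_ifs <;> ring
/-- Suppose `n = dim V ≥ 2r` (the form with matrix `Q` being symmetric
or skew-symmetric and nondegenerate).  Then for `1 ≤ l ≤ r`,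
`dim B(ε,n,r)_l = C(r,l)² · (2l-1)!!`, and hence
`dim B(ε,n,r) = 1 + ∑_{l=1}^{r} C(r,l)²·(2l-1)!!`. -/
theorem enhancedBrauer_finrank {n r : ℕ} (hn : 2 * r ≤ n)
    (Q : Matrix (Fin n) (Fin n) ℂ) (hQ : IsUnit Q) (hform : Qᵀ = Q ∨ Qᵀ = -Q) :
    (∀ l, 1 ≤ l → l ≤ r →
        Module.finrank ℂ (enhancedBrauerLevel n r Q l).toSubmodule =
          (r.choose l) ^ 2 * Nat.doubleFactorial (2 * l - 1)) ∧
      Module.finrank ℂ (enhancedBrauer n r Q).toSubmodule =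
        1 + ∑ l ∈ Finset.Icc 1 r, (r.choose l) ^ 2 * Nat.doubleFactorial (2 * l - 1) := by
  constructor
  · intro l h1 h2
    have h : (enhancedBrauerLevel n r Q l).toSubmodule = LS n r (fun m => m = l) Q := by
      apply adjoin_eq
      intro M
      refine or_congr Iff.rfl ⟨?_, ?_⟩
      · rintro ⟨I, rfl, A, hA, rfl⟩
        exact ⟨I, rfl, A, hA, rfl⟩
      · rintro ⟨I, rfl, A, hA, rfl⟩
        exact ⟨I, rfl, A, hA, rfl⟩
    rw [h, finrank_LS _ hn Q hQ hform, Finset.sum_ite_eq', if_pos (Finset.mem_range.2 (by omega))]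
  · have h : (enhancedBrauer n r Q).toSubmodule = LS n r (fun _ => True) Q := by
      apply adjoin_eq
      intro M
      refine or_congr ?_ ?_
      · refine exists_congr fun s => ?_
        have : (PsiMat s : Matrix (Fin r → Fin (n + 1)) (Fin r → Fin (n + 1)) ℂ) =
            PsiS (fun _ => True) s := by
          ext k q
          simp [PsiMat, PsiS]
        rw [this]
      · simp
    rw [h, finrank_LS _ hn Q hQ hform, Finset.sum_range_succ']
    simp only [if_true]
    rw [add_comm, Finset.range_eq_Ico,
      Finset.sum_Ico_add' (fun l => r.choose l ^ 2 * Nat.doubleFactorial (2 * l - 1)) 0 r 1]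
    congr 1
    simp

end EnhancedBrauer
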